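/- arXiv:cs/0511078 — 4 statements merged into one kernel-verified Lean document; each statement's English description precedes it below -/
import Mathlib

section
/- Let ψ₁ and ψ₂ be continuous and strictly monotone real functions on an interval [a,b]. Then the quasilinear means with respect to ψ₁ and ψ₂ agree for every n, every probability vector (p_1,…,p_n), and every choice of values x_1,…,x_n ∈ [a,b] — i.e. ψ₁⁻¹(Σ_k p_k ψ₁(x_k)) = ψ₂⁻¹(Σ_k p_k ψ₂(x_k)) always holds — if and only if there exist real constants α ≠ 0 and β such that ψ₁(x) = α ψ₂(x) + β for all x ∈ [a,b]. -/
open Finset Set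

/-- A strictly monotone or strictly antitone function on a set is injective there. -/
theorem injOn_of_strictMonoOn_or_strictAntiOn {s : Set ℝ} {f : ℝ → ℝ}
    (hf : StrictMonoOn f s ∨ StrictAntiOn f s) : Set.InjOn f s :=
  hf.elim StrictMonoOn.injOn StrictAntiOn.injOn

/-- A strictly monotone or strictly antitone function on `[a, b]` takes values in the segment
between its values at the endpoints. -/
theorem mem_segment_of_strictMonoOn_or_strictAntiOn {a b x : ℝ} {f : ℝ → ℝ}
    (hf : StrictMonoOn f (Set.Icc a b) ∨ StrictAntiOn f (Set.Icc a b))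
    (hx : x ∈ Set.Icc a b) : f x ∈ segment ℝ (f a) (f b) := by
  have hab : a ≤ b := hx.1.trans hx.2
  have ha : a ∈ Set.Icc a b := Set.left_mem_Icc.2 hab
  have hb : b ∈ Set.Icc a b := Set.right_mem_Icc.2 hab
  rw [segment_eq_uIcc, Set.mem_uIcc]
  rcases hf with hf | hf
  · exact Or.inl ⟨hf.monotoneOn ha hx hx.1, hf.monotoneOn hx hb hx.2⟩
  · exact Or.inr ⟨hf.antitoneOn hx hb hx.2, hf.antitoneOn ha hx hx.1⟩

/-- **KN-equivalence of two KN-functions.**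
Two continuous strictly monotone functions `ψ₁, ψ₂` on `[a,b]` produce the same
quasilinear mean for every probability vector `p` and every tuple of values in
`[a,b]` (the means being characterized as the points `m₁, m₂ ∈ [a,b]` where
`ψᵢ mᵢ = ∑ k, p k * ψᵢ (x k)`) if and only if `ψ₁ = α • ψ₂ + β` on `[a,b]`
for some constants `α ≠ 0` and `β`. -/
theorem kn_equivalent_iff_affine_related
    (a b : ℝ) (hab : a ≤ b) (ψ₁ ψ₂ : ℝ → ℝ)
    (hψ₁c : ContinuousOn ψ₁ (Set.Icc a b))
    (hψ₁m : StrictMonoOn ψ₁ (Set.Icc a b) ∨ StrictAntiOn ψ₁ (Set.Icc a b))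
    (hψ₂c : ContinuousOn ψ₂ (Set.Icc a b))
    (hψ₂m : StrictMonoOn ψ₂ (Set.Icc a b) ∨ StrictAntiOn ψ₂ (Set.Icc a b)) :
    (∀ (n : ℕ) (p : Fin n → ℝ) (x : Fin n → ℝ),
        (∀ k, 0 ≤ p k) → ∑ k, p k = 1 → (∀ k, x k ∈ Set.Icc a b) →
        ∀ m₁ ∈ Set.Icc a b, ∀ m₂ ∈ Set.Icc a b,
          ψ₁ m₁ = ∑ k, p k * ψ₁ (x k) →
          ψ₂ m₂ = ∑ k, p k * ψ₂ (x k) →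
          m₁ = m₂)
    ↔ ∃ α β : ℝ, α ≠ 0 ∧ ∀ x ∈ Set.Icc a b, ψ₁ x = α * ψ₂ x + β := by
  have ha : a ∈ Set.Icc a b := Set.left_mem_Icc.2 hab
  have hb : b ∈ Set.Icc a b := Set.right_mem_Icc.2 hab
  have inj₁ := injOn_of_strictMonoOn_or_strictAntiOn hψ₁m
  have inj₂ := injOn_of_strictMonoOn_or_strictAntiOn hψ₂m
  constructor
  · intro h
    rcases hab.eq_or_lt with rfl | hlt
    · refine ⟨1, ψ₁ a - ψ₂ a, one_ne_zero, fun x hx => ?_⟩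
      obtain rfl : x = a := le_antisymm hx.2 hx.1
      ring
    have hd₁ : ψ₁ b - ψ₁ a ≠ 0 := sub_ne_zero.2 fun e => hlt.ne' (inj₁ hb ha e)
    have hd₂ : ψ₂ b - ψ₂ a ≠ 0 := sub_ne_zero.2 fun e => hlt.ne' (inj₂ hb ha e)
    refine ⟨(ψ₁ b - ψ₁ a) / (ψ₂ b - ψ₂ a),
      ψ₁ a - (ψ₁ b - ψ₁ a) / (ψ₂ b - ψ₂ a) * ψ₂ a, div_ne_zero hd₁ hd₂, fun x hx => ?_⟩
    obtain ⟨s, t, hs, ht, hst, hψ₂x⟩ := mem_segment_of_strictMonoOn_or_strictAntiOn hψ₂m hx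
    rw [smul_eq_mul, smul_eq_mul] at hψ₂x
    have hmem : s * ψ₁ a + t * ψ₁ b ∈ Set.uIcc (ψ₁ a) (ψ₁ b) := by
      rw [← segment_eq_uIcc]
      exact ⟨s, t, hs, ht, hst, rfl⟩
    obtain ⟨m, hm, hψ₁m'⟩ :=
      intermediate_value_uIcc (by rwa [Set.uIcc_of_le hab]) hmem
    rw [Set.uIcc_of_le hab] at hm
    obtain rfl : m = x := h 2 ![s, t] ![a, b] (by simp [Fin.forall_fin_two, hs, ht])
      (by simpa [Fin.sum_univ_two] using hst) (by simp [Fin.forall_fin_two, hab])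
      m hm x hx (by simpa [Fin.sum_univ_two] using hψ₁m')
      (by simpa [Fin.sum_univ_two] using hψ₂x.symm)
    obtain rfl : s = 1 - t := eq_sub_of_add_eq hst
    rw [hψ₁m', ← hψ₂x]
    field_simp
    ring
  · rintro ⟨α, β, -, hαβ⟩ n p x - hp1 hx m₁ hm₁ m₂ hm₂ h₁ h₂
    refine inj₁ hm₁ hm₂ ?_
    rw [h₁, hαβ m₂ hm₂, h₂, Finset.mul_sum]
    calc ∑ k, p k * ψ₁ (x k) = ∑ k, (α * (p k * ψ₂ (x k)) + p k * β) :=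
          Finset.sum_congr rfl fun k _ => by rw [hαβ _ (hx k)]; ring
      _ = ∑ k, α * (p k * ψ₂ (x k)) + β := by
          rw [Finset.sum_add_distrib, ← Finset.sum_mul, hp1, one_mul]
end

section
/- Let ψ : ℝ → ℝ be continuous and strictly monotone. The translation property ψ⁻¹(Σ_{k=1}^n p_k ψ(x_k + c)) = ψ⁻¹(Σ_{k=1}^n p_k ψ(x_k)) + c holds for every n, every probability vector (p_1,…,p_n), every tuple of reals x_1,…,x_n, and every real constant c, if and only if ψ is either affine (ψ(x) = αx + β with α ≠ 0) or exponential-affine (ψ(x) = α e^{γx} + β with α ≠ 0, γ ≠ 0). -/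
open Finset Set Real

/-- If each translate of `ψ` is an affine function of `ψ`, then quasilinear means translate. -/
theorem mean_translate_of_affine {ψ : ℝ → ℝ} (hψ : Function.Injective ψ) {a b c : ℝ}
    (h : ∀ x, ψ (x + c) = a * ψ x + b) {n : ℕ} {p x : Fin n → ℝ} (hp : ∑ k, p k = 1) {m₁ m₂ : ℝ}
    (h₁ : ψ m₁ = ∑ k, p k * ψ (x k + c)) (h₂ : ψ m₂ = ∑ k, p k * ψ (x k)) : m₁ = m₂ + c := by
  apply hψ
  rw [h₁, h m₂, h₂, Finset.mul_sum]
  calc ∑ k, p k * ψ (x k + c) = ∑ k, (a * (p k * ψ (x k)) + p k * b) :=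
        Finset.sum_congr rfl fun k _ => by rw [h]; ring
    _ = _ := by rw [Finset.sum_add_distrib, ← Finset.sum_mul, hp, one_mul]

/-- If binary quasilinear means translate, then increments of `ψ` and of its translate are
proportional. -/
theorem increments_proportional_of_le {ψ : ℝ → ℝ} (hψc : Continuous ψ)
    (hψm : StrictMono ψ ∨ StrictAnti ψ) {c : ℝ}
    (H : ∀ t x z m₁ m₂ : ℝ, 0 ≤ t → t ≤ 1 →
      ψ m₁ = (1 - t) * ψ (x + c) + t * ψ (z + c) →
      ψ m₂ = (1 - t) * ψ x + t * ψ z → m₁ = m₂ + c)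
    {x y z : ℝ} (hxy : x ≤ y) (hyz : y ≤ z) :
    (ψ (y + c) - ψ (x + c)) * (ψ z - ψ x) = (ψ (z + c) - ψ (x + c)) * (ψ y - ψ x) := by
  have hinj : Function.Injective ψ := hψm.elim StrictMono.injective StrictAnti.injective
  rcases eq_or_ne x z with rfl | hxz
  · rw [le_antisymm hyz hxy]
  have hd : ψ z - ψ x ≠ 0 := sub_ne_zero.2 (hinj.ne hxz.symm)
  obtain ⟨t, ht⟩ : ∃ t, t = (ψ y - ψ x) / (ψ z - ψ x) := ⟨_, rfl⟩
  have ht' : t * (ψ z - ψ x) = ψ y - ψ x := by rw [ht]; field_simp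
  have ht01 : 0 ≤ t ∧ t ≤ 1 := by
    rw [ht]
    rcases hψm with h | h
    · have h1 := h.monotone hxy
      have h2 := h.monotone hyz
      exact ⟨div_nonneg (by linarith) (by linarith), div_le_one_of_le₀ (by linarith) (by linarith)⟩
    · have h1 := h.antitone hxy
      have h2 := h.antitone hyz
      exact ⟨div_nonneg_of_nonpos (by linarith) (by linarith),
        div_le_one_of_ge (by linarith) (by linarith)⟩
  have hconv : Convex ℝ (Set.range ψ) := (isPreconnected_range hψc).ordConnected.convex
  obtain ⟨m, hm⟩ := hconv (Set.mem_range_self (x + c)) (Set.mem_range_self (z + c))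
    (sub_nonneg.2 ht01.2) ht01.1 (sub_add_cancel 1 t)
  simp only [smul_eq_mul] at hm
  have hmy := H t x z m y ht01.1 ht01.2 hm (by linear_combination -ht')
  rw [hmy] at hm
  rw [hm, ← ht']
  ring

theorem increments_proportional {ψ : ℝ → ℝ} (hψc : Continuous ψ)
    (hψm : StrictMono ψ ∨ StrictAnti ψ) {c : ℝ}
    (H : ∀ t x z m₁ m₂ : ℝ, 0 ≤ t → t ≤ 1 →
      ψ m₁ = (1 - t) * ψ (x + c) + t * ψ (z + c) →
      ψ m₂ = (1 - t) * ψ x + t * ψ z → m₁ = m₂ + c) (x : ℝ) :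
    (ψ (x + c) - ψ c) * (ψ 1 - ψ 0) = (ψ (1 + c) - ψ c) * (ψ x - ψ 0) := by
  rcases le_total x 0 with h0 | h0
  · have h := increments_proportional_of_le hψc hψm H h0 zero_le_one
    rw [zero_add] at h
    linear_combination -h
  · rcases le_total x 1 with h1 | h1
    · simpa using increments_proportional_of_le hψc hψm H h0 h1
    · have h := increments_proportional_of_le hψc hψm H zero_le_one h1
      rw [zero_add] at h
      linear_combination -h

theorem eq_mul_of_continuous_of_map_add {f : ℝ → ℝ} (hf : Continuous f)
    (hadd : ∀ x y, f (x + y) = f x + f y) (x : ℝ) : f x = f 1 * x := by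
  simpa [mul_comm] using map_real_smul (AddMonoidHom.mk' f hadd) hf x 1

theorem eq_exp_of_continuous_of_map_add {g : ℝ → ℝ} (hg : Continuous g) (h0 : g 0 = 1)
    (hmul : ∀ x y, g (x + y) = g x * g y) : ∃ γ, ∀ x, g x = Real.exp (γ * x) := by
  have hne (x : ℝ) : g x ≠ 0 := by
    intro h
    have := hmul x (-x)
    simp [h, h0] at this
  have hpos (x : ℝ) : 0 < g x := by
    have h := hmul (x / 2) (x / 2)
    rw [add_halves] at h
    rw [h]
    exact mul_self_pos.2 (hne _)
  refine ⟨Real.log (g 1), fun x => ?_⟩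
  rw [← eq_mul_of_continuous_of_map_add (hg.log hne)
    (fun x y => by rw [hmul, Real.log_mul (hne x) (hne y)]) x, Real.exp_log (hpos x)]

/-- Continuous injective solutions of `f (x + c) = f c + A c * f x` are linear or exponential. -/
theorem linear_or_exp_of_map_add {f A : ℝ → ℝ} (hf : Continuous f) (hinj : Function.Injective f)
    (h0 : f 0 = 0) (h : ∀ x c, f (x + c) = f c + A c * f x) :
    (∃ α, α ≠ 0 ∧ ∀ x, f x = α * x) ∨
      ∃ α γ, α ≠ 0 ∧ γ ≠ 0 ∧ ∀ x, f x = α * Real.exp (γ * x) - α := by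
  have h1 : f 1 ≠ 0 := h0 ▸ hinj.ne one_ne_zero
  obtain ⟨k, hk⟩ : ∃ k, k = (A 1 - 1) / f 1 := ⟨_, rfl⟩
  have hk' : k * f 1 = A 1 - 1 := by rw [hk]; field_simp
  have hA (c : ℝ) : A c = 1 + k * f c := by
    apply mul_right_cancel₀ h1
    have e1 := h 1 c
    have e2 := h c 1
    rw [add_comm c 1] at e2
    linear_combination e2 - e1 - f c * hk'
  rcases eq_or_ne k 0 with rfl | hk0
  · left
    exact ⟨f 1, h1, eq_mul_of_continuous_of_map_add hf fun x y => by rw [h, hA]; ring⟩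
  · right
    obtain ⟨γ, hγ⟩ := eq_exp_of_continuous_of_map_add (g := fun x => 1 + k * f x)
      (by fun_prop) (by simp [h0]) (fun x y => by simp only [h, hA]; ring)
    refine ⟨k⁻¹, γ, inv_ne_zero hk0, ?_, fun x => ?_⟩
    · rintro rfl
      have := hγ 1
      simp [hk0, h1] at this
    · rw [← hγ x]
      field_simp
      ring

/-- **Theorem 3 (translativity of quasilinear means).**
For a continuous strictly monotone `ψ : ℝ → ℝ`, the translation property
`⟨X + c⟩_ψ = ⟨X⟩_ψ + c` holds for all probability vectors, value tuples and
constants `c` (the means being characterized by `ψ m = ∑ k, p k * ψ (·)`)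
if and only if `ψ` is affine (`ψ x = α x + β`, `α ≠ 0`) or exponential-affine
(`ψ x = α * exp (γ x) + β`, `α ≠ 0`, `γ ≠ 0`). -/
theorem kn_translative_iff_linear_or_exponential
    (ψ : ℝ → ℝ) (hψc : Continuous ψ) (hψm : StrictMono ψ ∨ StrictAnti ψ) :
    (∀ (n : ℕ) (p : Fin n → ℝ) (x : Fin n → ℝ) (c : ℝ),
        (∀ k, 0 ≤ p k) → ∑ k, p k = 1 →
        ∀ m₁ m₂ : ℝ,
          ψ m₁ = ∑ k, p k * ψ (x k + c) →
          ψ m₂ = ∑ k, p k * ψ (x k) →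
          m₁ = m₂ + c)
    ↔ ((∃ α β : ℝ, α ≠ 0 ∧ ∀ x, ψ x = α * x + β) ∨
       (∃ α β γ : ℝ, α ≠ 0 ∧ γ ≠ 0 ∧ ∀ x, ψ x = α * Real.exp (γ * x) + β)) := by
  have hinj : Function.Injective ψ := hψm.elim StrictMono.injective StrictAnti.injective
  constructor
  · intro H
    have hd : ψ 1 - ψ 0 ≠ 0 := sub_ne_zero.2 (hinj.ne one_ne_zero)
    have hprop (x c : ℝ) :=
      increments_proportional hψc hψm (c := c) (fun t x z m₁ m₂ ht0 ht1 hm₁ hm₂ =>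
        H 2 ![1 - t, t] ![x, z] c (by simp [Fin.forall_fin_two, ht0, ht1]) (by simp) m₁ m₂
          (by simpa using hm₁) (by simpa using hm₂)) x
    have hf := linear_or_exp_of_map_add (f := fun x => ψ x - ψ 0)
      (A := fun c => (ψ (1 + c) - ψ c) / (ψ 1 - ψ 0)) (by fun_prop)
      (fun x y hxy => hinj (sub_left_injective hxy)) (sub_self _) (fun x c => by
        field_simp
        linear_combination hprop x c)
    rcases hf with ⟨α, hα, h⟩ | ⟨α, γ, hα, hγ, h⟩
    · exact Or.inl ⟨α, ψ 0, hα, fun x => sub_eq_iff_eq_add.1 (h x)⟩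
    · exact Or.inr ⟨α, ψ 0 - α, γ, hα, hγ, fun x => by linear_combination h x⟩
  · rintro (⟨α, β, -, h⟩ | ⟨α, β, γ, -, -, h⟩) n p x c - hp m₁ m₂ h₁ h₂
    · exact mean_translate_of_affine hinj (a := 1) (b := α * c)
        (fun x => by rw [h, h]; ring) hp h₁ h₂
    · exact mean_translate_of_affine hinj (a := Real.exp (γ * c)) (b := β - β * Real.exp (γ * c))
        (fun x => by rw [h, h, mul_add, Real.exp_add]; ring) hp h₁ h₂
end

section
/- Let α ≠ 1 and let ψ(x) = e^{(1−α)x}. Then for every real d with d ≠ 0 and d ≠ 1, the homogeneity property of the quasilinear mean fails: there exist n, a probability vector (p_1,…,p_n) with all p_k > 0, and reals x_1,…,x_n such that (1/(1−α)) ln(Σ_k p_k e^{(1−α)d x_k}) ≠ (d/(1−α)) ln(Σ_k p_k e^{(1−α)x_k}). -/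
open Finset Real

/-- No real power other than the zeroth and the first preserves the midpoint of `1` and `2`. -/
theorem midpoint_one_two_rpow_ne {d : ℝ} (hd0 : d ≠ 0) (hd1 : d ≠ 1) :
    (1 + (2 : ℝ) ^ d) / 2 ≠ (3 / 2 : ℝ) ^ d := by
  have hmid : (1 / 2 : ℝ) * 1 + 1 / 2 * 2 = 3 / 2 := by norm_num
  rcases lt_or_gt_of_ne hd0 with hneg | hpos
  · have hsq : (2 : ℝ) ^ d = √2 ^ d * √2 ^ d := by
      rw [← Real.mul_rpow (by positivity) (by positivity), Real.mul_self_sqrt (by norm_num)]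
    have hsqrt : √2 < 3 / 2 := by
      rw [Real.sqrt_lt' (by norm_num)]; norm_num
    have hlt : (3 / 2 : ℝ) ^ d < √2 ^ d := Real.rpow_lt_rpow_of_neg (by positivity) hsqrt hneg
    nlinarith [sq_nonneg (√2 ^ d - 1)]
  rcases lt_or_gt_of_ne hd1 with hlt | hgt
  · have h := (Real.strictConcaveOn_rpow hpos hlt).2
      (show (1 : ℝ) ∈ Set.Ici 0 by simp) (show (2 : ℝ) ∈ Set.Ici 0 by simp)
      (by norm_num) one_half_pos one_half_pos (add_halves 1)
    simp only [smul_eq_mul, hmid, Real.one_rpow] at h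
    linarith
  · have h := (strictConvexOn_rpow hgt).2
      (show (1 : ℝ) ∈ Set.Ici 0 by simp) (show (2 : ℝ) ∈ Set.Ici 0 by simp)
      (by norm_num) one_half_pos one_half_pos (add_halves 1)
    simp only [smul_eq_mul, hmid, Real.one_rpow] at h
    linarith

/-- **Failure of homogeneity for the exponential KN-function.**
For `ψ x = exp ((1-α) x)` with `α ≠ 1` and any `d` with `d ≠ 0`, `d ≠ 1`,
homogeneity of the quasilinear mean fails: there exist a probability vector
with strictly positive entries and values `x k` such that
`(1/(1-α)) ln (∑ k, p k exp((1-α) d x k)) ≠ (d/(1-α)) ln (∑ k, p k exp((1-α) x k))`. -/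
theorem exponential_kn_mean_not_homogeneous
    (α : ℝ) (hα : α ≠ 1) (d : ℝ) (hd0 : d ≠ 0) (hd1 : d ≠ 1) :
    ∃ (n : ℕ) (p : Fin n → ℝ) (x : Fin n → ℝ),
      (∀ k, 0 < p k) ∧ ∑ k, p k = 1 ∧
      (1 / (1 - α)) * Real.log (∑ k, p k * Real.exp ((1 - α) * (d * x k))) ≠
        (d / (1 - α)) * Real.log (∑ k, p k * Real.exp ((1 - α) * x k)) := by
  have hα' : 1 - α ≠ 0 := sub_ne_zero.mpr hα.symm
  refine ⟨2, fun _ => 1 / 2, ![0, Real.log 2 / (1 - α)], fun _ => by norm_num, by norm_num, ?_⟩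
  intro h
  have hl : Real.exp ((1 - α) * (d * (Real.log 2 / (1 - α)))) = 2 ^ d := by
    rw [Real.rpow_def_of_pos two_pos]
    congr 1
    field_simp
  have hr : Real.exp ((1 - α) * (Real.log 2 / (1 - α))) = 2 := by
    rw [mul_div_cancel₀ _ hα', Real.exp_log two_pos]
  simp only [Fin.sum_univ_two, Matrix.cons_val_zero, Matrix.cons_val_one, mul_zero, Real.exp_zero,
    hl, hr] at h
  have hlog : Real.log ((1 + 2 ^ d) / 2) = Real.log ((3 / 2) ^ d) := by
    rw [Real.log_rpow (by norm_num)]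
    field_simp at h
    convert h using 2
    ring_nf
  exact midpoint_one_two_rpow_ne hd0 hd1
    (Real.log_injOn_pos (Set.mem_Ioi.mpr (by positivity)) (Set.mem_Ioi.mpr (by positivity)) hlog)
end

section
/- Let I = [a,b] be a compact interval of ℝ and let κ be a real-valued functional on the set of Borel probability measures on [a,b]. Then κ satisfies: (1) κ(δ_x) = x for every x ∈ [a,b], where δ_x is the Dirac measure at x; (2) if the cumulative distribution functions satisfy F_μ(t) ≤ F_ν(t) for all t, then κ(μ) ≥ κ(ν), with equality if and only if μ = ν; and (3) if κ(μ) = κ(ν), then κ(βμ + (1−β)λ) = κ(βν + (1−β)λ) for every β ∈ [0,1] and every probability measure λ on [a,b]; if and only if there exists a continuous strictly monotone function ψ on [a,b] such that κ(μ) = ψ⁻¹(∫ ψ dμ) for every probability measure μ on [a,b]. -/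
open MeasureTheory Set

/-- Probability measures carried by `[a, b]`. -/
def IsProbOn (a b : ℝ) (μ : Measure ℝ) : Prop :=
  IsProbabilityMeasure μ ∧ μ (Icc a b)ᶜ = 0

/-- The mixture `β μ + (1 - β) ν` for a real weight `β ∈ [0, 1]`. -/
noncomputable def mixture (β : ℝ) (μ ν : Measure ℝ) : Measure ℝ :=
  β.toNNReal • μ + (1 - β).toNNReal • ν

lemma IsProbOn.mono {a b c d : ℝ} {μ : Measure ℝ} (h : IsProbOn c d μ) (hac : a ≤ c)
    (hdb : d ≤ b) : IsProbOn a b μ :=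
  ⟨h.1, measure_mono_null (compl_subset_compl.2 (Icc_subset_Icc hac hdb)) h.2⟩

lemma isProbOn_dirac {a b x : ℝ} (hx : x ∈ Icc a b) : IsProbOn a b (Measure.dirac x) := by
  refine ⟨inferInstance, ?_⟩
  rw [Measure.dirac_apply' _ measurableSet_Icc.compl]
  simp [hx.1, hx.2]

lemma mixture_real {β : ℝ} (hβ : β ∈ Icc (0 : ℝ) 1) (μ ν : Measure ℝ) [IsFiniteMeasure μ]
    [IsFiniteMeasure ν] (s : Set ℝ) :
    (mixture β μ ν).real s = β * μ.real s + (1 - β) * ν.real s := by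
  rw [mixture, measureReal_add_apply, measureReal_nnreal_smul_apply,
    measureReal_nnreal_smul_apply, Real.coe_toNNReal _ hβ.1,
    Real.coe_toNNReal _ (sub_nonneg.2 hβ.2)]

lemma IsProbOn.mixture {a b β : ℝ} (hβ : β ∈ Icc (0 : ℝ) 1) {μ ν : Measure ℝ}
    (hμ : IsProbOn a b μ) (hν : IsProbOn a b ν) : IsProbOn a b (mixture β μ ν) := by
  have := hμ.1
  have := hν.1
  refine ⟨⟨?_⟩, by simp [_root_.mixture, hμ.2, hν.2]⟩
  have h : (_root_.mixture β μ ν).real univ = 1 := by rw [mixture_real hβ]; simp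
  have : (_root_.mixture β μ ν) univ ≠ 0 := fun h0 => by simp [Measure.real, h0] at h
  rwa [Measure.real, ENNReal.toReal_eq_one_iff] at h

lemma ext_of_real {μ ν : Measure ℝ} [IsFiniteMeasure μ] [IsFiniteMeasure ν]
    (h : ∀ s, MeasurableSet s → μ.real s = ν.real s) : μ = ν :=
  Measure.ext fun s hs => (measureReal_eq_measureReal_iff).1 (h s hs)

lemma mixture_symm {β : ℝ} (μ ν : Measure ℝ) : mixture β μ ν = mixture (1 - β) ν μ := by
  simp [mixture, add_comm]

lemma integral_mixture {β : ℝ} (hβ : β ∈ Icc (0 : ℝ) 1) {μ ν : Measure ℝ} {f : ℝ → ℝ}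
    (hμ : Integrable f μ) (hν : Integrable f ν) :
    ∫ x, f x ∂(mixture β μ ν) = β * ∫ x, f x ∂μ + (1 - β) * ∫ x, f x ∂ν := by
  rw [mixture, integral_add_measure (hμ.smul_measure_nnreal) (hν.smul_measure_nnreal),
    integral_smul_nnreal_measure, integral_smul_nnreal_measure, NNReal.smul_def, NNReal.smul_def,
    Real.coe_toNNReal _ hβ.1, Real.coe_toNNReal _ (sub_nonneg.2 hβ.2), smul_eq_mul, smul_eq_mul]

lemma IsProbOn.integrable {a b : ℝ} {μ : Measure ℝ} (hμ : IsProbOn a b μ) {f : ℝ → ℝ}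
    (hf : ContinuousOn f (Icc a b)) : Integrable f μ := by
  have := hμ.1
  have h := hf.integrableOn_compact (μ := μ) isCompact_Icc
  rwa [IntegrableOn, Measure.restrict_eq_self_of_ae_mem (s := Icc a b) hμ.2] at h

/-- Restricting a probability measure to a half-line and its complement writes it as a mixture. -/
lemma IsProbOn.exists_mixture {c d : ℝ} (m : ℝ) {μ : Measure ℝ}
    (hμ : IsProbOn c d μ) :
    IsProbOn c m μ ∨ IsProbOn m d μ ∨ ∃ β ∈ Icc (0 : ℝ) 1, ∃ μ₁ μ₂,
      IsProbOn c m μ₁ ∧ IsProbOn m d μ₂ ∧ μ = _root_.mixture β μ₁ μ₂ := by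
  have := hμ.1
  by_cases h0 : μ (Iic m) = 0
  · refine .inr (.inl ⟨hμ.1, measure_mono_null ?_ (measure_union_null hμ.2 h0)⟩)
    intro x hx
    simp only [mem_compl_iff, mem_Icc, mem_union, mem_Iic, not_and_or, not_le] at *
    grind
  by_cases h1 : μ (Iic m)ᶜ = 0
  · refine .inl ⟨hμ.1, measure_mono_null ?_ (measure_union_null hμ.2 h1)⟩
    intro x hx
    simp only [mem_compl_iff, mem_Icc, mem_union, mem_Iic, not_and_or, not_le] at *
    grind
  have hp₁ := ProbabilityTheory.cond_isProbabilityMeasure h0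
  have hp₂ := ProbabilityTheory.cond_isProbabilityMeasure h1
  have hβ : μ.real (Iic m) ∈ Icc (0 : ℝ) 1 := ⟨measureReal_nonneg, measureReal_le_one⟩
  refine .inr (.inr ⟨μ.real (Iic m), hβ, ProbabilityTheory.cond μ (Iic m),
    ProbabilityTheory.cond μ (Iic m)ᶜ, ⟨hp₁, ?_⟩, ⟨hp₂, ?_⟩, ?_⟩)
  · rw [ProbabilityTheory.cond_apply measurableSet_Iic, mul_eq_zero]
    refine .inr (measure_mono_null ?_ hμ.2)
    intro x hx
    simp only [mem_compl_iff, mem_Icc, mem_inter_iff, mem_Iic, not_and_or, not_le] at *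
    grind
  · rw [ProbabilityTheory.cond_apply measurableSet_Iic.compl, mul_eq_zero]
    refine .inr (measure_mono_null ?_ hμ.2)
    intro x hx
    simp only [mem_compl_iff, mem_Icc, mem_inter_iff, mem_Iic, not_and_or, not_le] at *
    grind
  · have h₁ : IsProbOn c d (ProbabilityTheory.cond μ (Iic m)) :=
      ⟨hp₁, ProbabilityTheory.cond_absolutelyContinuous hμ.2⟩
    have h₂ : IsProbOn c d (ProbabilityTheory.cond μ (Iic m)ᶜ) :=
      ⟨hp₂, ProbabilityTheory.cond_absolutelyContinuous hμ.2⟩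
    have := (IsProbOn.mixture hβ h₁ h₂).1
    refine ext_of_real fun s hs => ?_
    rw [mixture_real hβ, measureReal_def (ProbabilityTheory.cond μ _),
      measureReal_def (ProbabilityTheory.cond μ _), ProbabilityTheory.cond_apply measurableSet_Iic,
      ProbabilityTheory.cond_apply measurableSet_Iic.compl, ENNReal.toReal_mul, ENNReal.toReal_mul,
      ENNReal.toReal_inv, ENNReal.toReal_inv, ← measureReal_def, ← measureReal_def,
      ← measureReal_def, ← measureReal_def,
      ← probReal_compl_eq_one_sub measurableSet_Iic,
      mul_inv_cancel_left₀ ((measureReal_ne_zero_iff).2 h0),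
      mul_inv_cancel_left₀ ((measureReal_ne_zero_iff).2 h1),
      inter_comm, inter_comm _ s, ← sdiff_eq, measureReal_inter_add_sdiff measurableSet_Iic]

lemma dirac_real_Iic (x t : ℝ) :
    (Measure.dirac x).real (Iic t) = if x ≤ t then 1 else 0 := by
  rw [measureReal_def, Measure.dirac_apply' _ measurableSet_Iic]
  by_cases h : x ≤ t <;> simp [h]

lemma le_cdf_and_cdf_le {c d : ℝ} {μ : Measure ℝ} (hμ : IsProbOn c d μ) (t : ℝ) :
    (Measure.dirac d).real (Iic t) ≤ μ.real (Iic t) ∧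
      μ.real (Iic t) ≤ (Measure.dirac c).real (Iic t) := by
  have := hμ.1
  rw [dirac_real_Iic, dirac_real_Iic]
  constructor
  · split_ifs with h
    · have h0 : μ (Iic t)ᶜ = 0 := measure_mono_null
        (compl_subset_compl.2 fun x hx => hx.2.trans h) hμ.2
      rw [measureReal_def, (prob_compl_eq_zero_iff measurableSet_Iic).1 h0, ENNReal.toReal_one]
    · exact measureReal_nonneg
  · split_ifs with h
    · exact measureReal_le_one
    · have h0 : μ (Iic t) = 0 := measure_mono_null
        (show Iic t ⊆ (Icc c d)ᶜ from fun x hx hx' => h (hx'.1.trans hx)) hμ.2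
      rw [measureReal_def, h0, ENNReal.toReal_zero]

/-- First order stochastic dominance orders the means, and strictly so for distinct measures. -/
lemma integral_id_le_of_cdf_le {c d : ℝ} {μ ν : Measure ℝ} (hμ : IsProbOn c d μ)
    (hν : IsProbOn c d ν) (h : ∀ t, μ (Iic t) ≤ ν (Iic t)) :
    ∫ x, x ∂ν ≤ ∫ x, x ∂μ ∧ (∫ x, x ∂ν = ∫ x, x ∂μ → μ = ν) := by
  have tail : ∀ {ρ : Measure ℝ}, IsProbOn c d ρ →
      ENNReal.ofReal ((∫ x, x ∂ρ) - c) = ∫⁻ t in Ioi 0, ρ (Ioi (c + t)) ∧ 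
        0 ≤ (∫ x, x ∂ρ) - c := by
    intro ρ hρ
    have := hρ.1
    have hi : Integrable (fun x : ℝ => x) ρ := hρ.integrable continuousOn_id
    have h0 : 0 ≤ᵐ[ρ] fun x => x - c := by
      filter_upwards [show ∀ᵐ x ∂ρ, x ∈ Icc c d from hρ.2] with x hx
      exact sub_nonneg.2 hx.1
    have e : (∫ x, x ∂ρ) - c = ∫ x, (x - c) ∂ρ := by
      rw [integral_sub hi (integrable_const _)]; simp
    rw [e]
    refine ⟨?_, integral_nonneg_of_ae h0⟩
    rw [ofReal_integral_eq_lintegral_ofReal (f := fun x => x - c)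
      (hi.sub (integrable_const _)) h0,
      lintegral_eq_lintegral_meas_lt _ h0 (by fun_prop)]
    congr! with t
    ext x; simp [lt_sub_iff_add_lt']
  obtain ⟨eμ, pμ⟩ := tail hμ
  obtain ⟨eν, pν⟩ := tail hν
  have := hμ.1
  have := hν.1
  have hle : ∀ t, ν (Ioi t) ≤ μ (Ioi t) := fun t => by
    rw [← compl_Iic, prob_compl_eq_one_sub measurableSet_Iic,
      prob_compl_eq_one_sub measurableSet_Iic]
    exact tsub_le_tsub_left (h t) 1
  constructor
  · have := lintegral_mono (μ := volume.restrict (Ioi (0 : ℝ))) fun t => hle (c + t)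
    rw [← eμ, ← eν, ENNReal.ofReal_le_ofReal_iff pμ] at this
    linarith
  · intro he
    have hmeas : Measurable fun t => μ (Ioi (c + t)) :=
      Antitone.measurable fun s t hst => measure_mono (Ioi_subset_Ioi (by linarith))
    have hae := ae_eq_of_ae_le_of_lintegral_le (μ := volume.restrict (Ioi (0 : ℝ)))
      (.of_forall fun t => hle (c + t)) (by rw [← eν]; exact ENNReal.ofReal_ne_top)
      hmeas.aemeasurable (by rw [← eμ, ← eν, he])
    have hcdf : ∀ x, ProbabilityTheory.cdf μ x ≤ ProbabilityTheory.cdf ν x := fun x => by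
      rw [ProbabilityTheory.cdf_eq_real, ProbabilityTheory.cdf_eq_real]
      exact ENNReal.toReal_mono (measure_ne_top _ _) (h x)
    refine Measure.eq_of_cdf μ ν (StieltjesFunction.ext fun x => (hcdf x).antisymm ?_)
    by_contra! hlt
    have hcx : c ≤ x := by
      by_contra! hxc
      have h0 : ν (Iic x) = 0 := measure_mono_null
        (show Iic x ⊆ (Icc c d)ᶜ from fun y hy hy' => by linarith [hy'.1, mem_Iic.1 hy]) hν.2
      have : ProbabilityTheory.cdf ν x = 0 := by
        rw [ProbabilityTheory.cdf_eq_real, Measure.real, h0, ENNReal.toReal_zero]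
      linarith [ProbabilityTheory.cdf_nonneg μ x]
    obtain ⟨u, hxu, hu⟩ := mem_nhdsGE_iff_exists_Ico_subset.1
      (((ProbabilityTheory.cdf μ).right_continuous x).eventually (gt_mem_nhds hlt))
    have hnull : (volume.restrict (Ioi (0 : ℝ))) (Ioo (x - c) (u - c)) = 0 := by
      refine measure_mono_null ?_ (ae_iff.1 hae)
      intro t ht hEq
      have h1 : ProbabilityTheory.cdf μ (c + t) < ProbabilityTheory.cdf ν x :=
        hu ⟨by linarith [ht.1], by linarith [ht.2]⟩
      have h2 := ProbabilityTheory.monotone_cdf ν (show x ≤ c + t by linarith [ht.1])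
      have h3 : ν.real (Ioi (c + t)) = μ.real (Ioi (c + t)) := congrArg ENNReal.toReal hEq
      rw [← compl_Iic, probReal_compl_eq_one_sub measurableSet_Iic,
        probReal_compl_eq_one_sub measurableSet_Iic, ← ProbabilityTheory.cdf_eq_real,
        ← ProbabilityTheory.cdf_eq_real] at h3
      linarith
    rw [Measure.restrict_apply measurableSet_Ioo, inter_eq_left.2
      (show Ioo (x - c) (u - c) ⊆ Ioi 0 from fun t ht => mem_Ioi.2 (by linarith [ht.1])),
      Real.volume_Ioo, ENNReal.ofReal_eq_zero] at hnull
    linarith [show x < u from hxu]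

/-- A continuous strictly increasing function on a compact interval extends to an order
automorphism of the line. -/
lemma exists_orderIso_extension {a b : ℝ} (hab : a ≤ b) {ψ : ℝ → ℝ}
    (hc : ContinuousOn ψ (Icc a b)) (hm : StrictMonoOn ψ (Icc a b)) :
    ∃ e : ℝ ≃o ℝ, ∀ x ∈ Icc a b, e x = ψ x := by
  set f : ℝ → ℝ := fun x => IccExtend hab ((Icc a b).domRestrict ψ) x + (x - projIcc a b hab x)
    with hf
  have hfc : Continuous f :=
    (hc.domRestrict.Icc_extend' (h := hab)).add
      (continuous_id.sub (continuous_subtype_val.comp continuous_projIcc))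
  have hlo : ∀ x ≤ a, f x = ψ a + (x - a) := fun x hx => by
    simp [hf, IccExtend_apply, domRestrict, projIcc_of_le_left hab hx,
      max_eq_left (min_le_of_right_le hx)]
  have hhi : ∀ x, b ≤ x → f x = ψ b + (x - b) := fun x hx => by
    simp [hf, IccExtend_apply, domRestrict, projIcc_of_right_le hab hx, hab, hx]
  have hmid : ∀ x ∈ Icc a b, f x = ψ x := fun x hx => by
    simp [hf, IccExtend_apply, domRestrict, projIcc_of_mem hab hx, hx.1, hx.2]
  have hmono : StrictMono f := by
    have h1 : StrictMonoOn f (Iic a) := fun x hx y hy hxy => by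
      rw [hlo x hx, hlo y hy]; linarith
    have h2 : StrictMonoOn f (Icc a b) := fun x hx y hy hxy => by
      rw [hmid x hx, hmid y hy]; exact hm hx hy hxy
    have h3 : StrictMonoOn f (Ici b) := fun x hx y hy hxy => by
      rw [hhi x hx, hhi y hy]; linarith
    have h12 := h1.union h2 isGreatest_Iic (isLeast_Icc hab)
    rw [Iic_union_Icc_eq_Iic hab] at h12
    exact h12.Iic_union_Ici h3
  have hsurj : Function.Surjective f := by
    refine hfc.surjective (Filter.tendsto_atTop.2 fun y => ?_) (Filter.tendsto_atBot.2 fun y => ?_)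
    · filter_upwards [Filter.eventually_ge_atTop b,
        Filter.eventually_ge_atTop (y - ψ b + b)] with x hx hx'
      rw [hhi x hx]; linarith
    · filter_upwards [Filter.eventually_le_atBot a,
        Filter.eventually_le_atBot (y - ψ a + a)] with x hx hx'
      rw [hlo x hx]; linarith
  exact ⟨hmono.orderIsoOfSurjective f hsurj, hmid⟩

lemma integral_le_of_cdf_le {a b : ℝ} (hab : a ≤ b) {ψ : ℝ → ℝ}
    (hc : ContinuousOn ψ (Icc a b)) (hm : StrictMonoOn ψ (Icc a b)) {μ ν : Measure ℝ}
    (hμ : IsProbOn a b μ) (hν : IsProbOn a b ν) (h : ∀ t, μ (Iic t) ≤ ν (Iic t)) :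
    ∫ x, ψ x ∂ν ≤ ∫ x, ψ x ∂μ ∧ (∫ x, ψ x ∂ν = ∫ x, ψ x ∂μ → μ = ν) := by
  obtain ⟨e, he⟩ := exists_orderIso_extension hab hc hm
  have hem : Measurable e := e.continuous.measurable
  have key : ∀ {ρ : Measure ℝ}, IsProbOn a b ρ → IsProbOn (e a) (e b) (ρ.map e) ∧
      ∫ x, ψ x ∂ρ = ∫ x, x ∂(ρ.map e) := by
    intro ρ hρ
    have := hρ.1
    refine ⟨⟨Measure.isProbabilityMeasure_map hem.aemeasurable, ?_⟩, ?_⟩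
    · rw [Measure.map_apply hem measurableSet_Icc.compl, preimage_compl, e.preimage_Icc]
      simpa using hρ.2
    · rw [integral_map hem.aemeasurable (by fun_prop)]
      refine integral_congr_ae ?_
      filter_upwards [show ∀ᵐ x ∂ρ, x ∈ Icc a b from hρ.2] with x hx using (he x hx).symm
  have hcdf : ∀ t, μ.map e (Iic t) ≤ ν.map e (Iic t) := fun t => by
    rw [Measure.map_apply hem measurableSet_Iic, Measure.map_apply hem measurableSet_Iic,
      e.preimage_Iic]
    exact h _
  have := integral_id_le_of_cdf_le (key hμ).1 (key hν).1 hcdf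
  rw [(key hμ).2, (key hν).2]
  refine ⟨this.1, fun h' => ?_⟩
  exact (e.toHomeomorph.measurableEmbedding.map_injective) (this.2 h')

/-- A functional on measures with the three axioms of a quasilinear mean: consistency on Dirac
masses, strict monotonicity for stochastic dominance, and independence under mixtures. -/
structure IsQuasilinear (a b : ℝ) (κ : Measure ℝ → ℝ) : Prop where
  dirac : ∀ x ∈ Icc a b, κ (Measure.dirac x) = x
  mono : ∀ {μ ν}, IsProbOn a b μ → IsProbOn a b ν →
    (∀ t, μ.real (Iic t) ≤ ν.real (Iic t)) → κ ν ≤ κ μ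
  eq : ∀ {μ ν}, IsProbOn a b μ → IsProbOn a b ν →
    (∀ t, μ.real (Iic t) ≤ ν.real (Iic t)) → κ ν = κ μ → μ = ν
  mixture_congr : ∀ {μ ν ρ}, IsProbOn a b μ → IsProbOn a b ν → IsProbOn a b ρ →
    ∀ {β : ℝ}, β ∈ Icc (0 : ℝ) 1 → κ μ = κ ν → κ (mixture β μ ρ) = κ (mixture β ν ρ)

namespace IsQuasilinear

variable {a b : ℝ} {κ : Measure ℝ → ℝ}

lemma mixture_congr₂ (h : IsQuasilinear a b κ) {μ ν ρ σ : Measure ℝ} (hμ : IsProbOn a b μ)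
    (hν : IsProbOn a b ν) (hρ : IsProbOn a b ρ) (hσ : IsProbOn a b σ) {β : ℝ}
    (hβ : β ∈ Icc (0 : ℝ) 1) (h₁ : κ μ = κ ν) (h₂ : κ ρ = κ σ) :
    κ (mixture β μ ρ) = κ (mixture β ν σ) := by
  rw [h.mixture_congr hμ hν hρ hβ h₁, mixture_symm, mixture_symm ν σ,
    h.mixture_congr hρ hσ hν ⟨sub_nonneg.2 hβ.2, sub_le_self _ hβ.1⟩ h₂]

lemma mem_Icc (h : IsQuasilinear a b κ) {c d : ℝ} (hac : a ≤ c) (hcd : c ≤ d) (hdb : d ≤ b)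
    {μ : Measure ℝ} (hμ : IsProbOn c d μ) : κ μ ∈ Icc c d := by
  have hμ' := hμ.mono hac hdb
  have hc : c ∈ Icc a b := ⟨hac, hcd.trans hdb⟩
  have hd : d ∈ Icc a b := ⟨hac.trans hcd, hdb⟩
  have h1 := h.mono hμ' (isProbOn_dirac hc) fun t => (le_cdf_and_cdf_le hμ t).2
  have h2 := h.mono (isProbOn_dirac hd) hμ' fun t => (le_cdf_and_cdf_le hμ t).1
  rw [h.dirac c hc] at h1
  rw [h.dirac d hd] at h2
  exact ⟨h1, h2⟩

lemma strictMonoOn (h : IsQuasilinear a b κ) (hab : a < b) :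
    StrictMonoOn (fun p => κ (mixture p (Measure.dirac b) (Measure.dirac a))) (Icc 0 1) := by
  intro p hp q hq hpq
  have ha := isProbOn_dirac (left_mem_Icc.2 hab.le)
  have hb := isProbOn_dirac (right_mem_Icc.2 hab.le)
  have hdom : ∀ t, (mixture q (Measure.dirac b) (Measure.dirac a)).real (Iic t) ≤
      (mixture p (Measure.dirac b) (Measure.dirac a)).real (Iic t) := fun t => by
    rw [mixture_real hq, mixture_real hp]
    nlinarith [(le_cdf_and_cdf_le hb t).2]
  refine (h.mono (hb.mixture hq ha) (hb.mixture hp ha) hdom).lt_of_ne fun he => ?_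
  have := congrArg (fun μ => μ.real (Iic a)) (h.eq (hb.mixture hq ha) (hb.mixture hp ha) hdom he)
  simp only [mixture_real hq, mixture_real hp, dirac_real_Iic, le_refl, hab.not_ge, if_true,
    if_false] at this
  linarith

lemma mixture_dirac_lt (h : IsQuasilinear a b κ) {u v : ℝ} (hu : u ∈ Icc a b)
    (hv : v ∈ Icc a b) (huv : u < v) {ρ : Measure ℝ} (hρ : IsProbOn a b ρ) {β : ℝ}
    (hβ : β ∈ Ioc (0 : ℝ) 1) :
    κ (mixture β (Measure.dirac u) ρ) < κ (mixture β (Measure.dirac v) ρ) := by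
  have hβ' := Ioc_subset_Icc_self hβ
  have := hρ.1
  have hU := (isProbOn_dirac hu).mixture hβ' hρ
  have hV := (isProbOn_dirac hv).mixture hβ' hρ
  have hdom : ∀ t, (mixture β (Measure.dirac v) ρ).real (Iic t) ≤
      (mixture β (Measure.dirac u) ρ).real (Iic t) := fun t => by
    rw [mixture_real hβ', mixture_real hβ']
    gcongr
    · exact hβ'.1
    · exact (le_cdf_and_cdf_le (isProbOn_dirac ⟨huv.le, le_rfl⟩) t).2
  refine (h.mono hV hU hdom).lt_of_ne fun he => ?_
  have := congrArg (fun μ => μ.real (Iic u)) (h.eq hV hU hdom he)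
  simp only [mixture_real hβ', dirac_real_Iic, le_refl, huv.not_ge, if_true, if_false] at this
  linarith [hβ.1]

lemma mixture_mixture {β p q : ℝ} (hβ : β ∈ Icc (0 : ℝ) 1) (hp : p ∈ Icc (0 : ℝ) 1)
    (hq : q ∈ Icc (0 : ℝ) 1) {μ ν : Measure ℝ} (hμ : IsProbOn a b μ) (hν : IsProbOn a b ν) :
    β * p + (1 - β) * q ∈ Icc (0 : ℝ) 1 ∧
    mixture β (mixture p μ ν) (mixture q μ ν) = mixture (β * p + (1 - β) * q) μ ν := by
  have hr : β * p + (1 - β) * q ∈ Icc (0 : ℝ) 1 :=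
    convex_Icc (0 : ℝ) 1 hp hq hβ.1 (sub_nonneg.2 hβ.2) (by ring)
  have := hμ.1
  have := hν.1
  have := (hμ.mixture hp hν).1
  have := (hμ.mixture hq hν).1
  have := ((hμ.mixture hp hν).mixture hβ (hμ.mixture hq hν)).1
  have := (hμ.mixture hr hν).1
  refine ⟨hr, ext_of_real fun s _ => ?_⟩
  rw [mixture_real hβ, mixture_real hp, mixture_real hq, mixture_real hr]
  ring

/-- The curve `p ↦ κ (p δ_b + (1 - p) δ_a)` has no jumps: a jump would be reproduced, by mixing
with the points of the curve, at uncountably many other parameters. -/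
lemma exists_eq (h : IsQuasilinear a b κ) (hab : a < b) {x : ℝ} (hx : x ∈ Icc a b) :
    ∃ p ∈ Icc (0 : ℝ) 1, κ (mixture p (Measure.dirac b) (Measure.dirac a)) = x := by
  have ha := isProbOn_dirac (left_mem_Icc.2 hab.le)
  have hb := isProbOn_dirac (right_mem_Icc.2 hab.le)
  set m : ℝ → Measure ℝ := fun p => mixture p (Measure.dirac b) (Measure.dirac a) with hm
  have hmP : ∀ {p}, p ∈ Icc (0 : ℝ) 1 → IsProbOn a b (m p) := fun hp => hb.mixture hp ha
  have hgI : ∀ {p}, p ∈ Icc (0 : ℝ) 1 → κ (m p) ∈ Icc a b := fun hp =>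
    h.mem_Icc le_rfl hab.le le_rfl (hmP hp)
  have hg : StrictMonoOn (fun p => κ (m p)) (Icc 0 1) := h.strictMonoOn hab
  have hg0 : κ (m 0) = a := by
    simpa [hm, mixture] using h.dirac a (left_mem_Icc.2 hab.le)
  have hg1 : κ (m 1) = b := by
    simpa [hm, mixture] using h.dirac b (right_mem_Icc.2 hab.le)
  have noGap : ∀ u ∈ Icc a b, ∀ v ∈ Icc a b, u < v →
      ¬ ∀ ε > 0, ∃ p ∈ Icc (0 : ℝ) 1, ∃ q ∈ Icc (0 : ℝ) 1, q - p ≤ ε ∧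
        κ (m p) ≤ u ∧ v ≤ κ (m q) := by
    intro u hu v hv huv hgap
    have hhalf : (1 / 2 : ℝ) ∈ Icc (0 : ℝ) 1 := by constructor <;> norm_num
    set k : ℝ → ℝ → ℝ := fun q x => κ (mixture (1 / 2) (Measure.dirac x) (m q)) with hk
    have hkg : ∀ {p q}, p ∈ Icc (0 : ℝ) 1 → q ∈ Icc (0 : ℝ) 1 →
        1 / 2 * p + (1 - 1 / 2) * q ∈ Icc (0 : ℝ) 1 ∧
        k q (κ (m p)) = κ (m (1 / 2 * p + (1 - 1 / 2) * q)) := fun {p q} hp hq => by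
      obtain ⟨h1, h2⟩ := mixture_mixture hhalf hp hq hb ha
      refine ⟨h1, ?_⟩
      simp only [hk, hm, ← h2]
      exact h.mixture_congr (isProbOn_dirac (hgI hp)) (hmP hp) (hmP hq) hhalf
        (h.dirac _ (hgI hp))
    have hkm : ∀ {q}, q ∈ Icc (0 : ℝ) 1 → StrictMonoOn (k q) (Icc a b) :=
      fun hq x hx y hy hxy => h.mixture_dirac_lt hx hy hxy (hmP hq) ⟨by norm_num, by norm_num⟩
    have hsep : ∀ {q r}, q ∈ Icc (0 : ℝ) 1 → r ∈ Icc (0 : ℝ) 1 → q < r → k q v ≤ k r u := by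
      intro q r hq hr hqr
      obtain ⟨s, hs, t, ht, hst, hsu, hvt⟩ := hgap (r - q) (sub_pos.2 hqr)
      calc k q v ≤ k q (κ (m t)) := (hkm hq).monotoneOn hv (hgI ht) hvt
        _ = _ := (hkg ht hq).2
        _ ≤ _ := hg.monotoneOn (hkg ht hq).1 (hkg hs hr).1 (by linarith)
        _ = _ := (hkg hs hr).2.symm
        _ ≤ k r u := (hkm hr).monotoneOn (hgI hs) hu hsu
    have hdisj : (Icc (0 : ℝ) 1).PairwiseDisjoint fun q => Ioo (k q u) (k q v) := by
      intro q hq r hr hqr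
      refine disjoint_left.2 fun z hz hz' => ?_
      rcases hqr.lt_or_gt with hlt | hlt
      · linarith [hsep hq hr hlt, hz.2, hz'.1]
      · linarith [hsep hr hq hlt, hz'.2, hz.1]
    exact (Cardinal.Real.Icc_countable_iff.not.2 zero_lt_one.not_ge)
      (hdisj.countable_of_isOpen (fun _ _ => isOpen_Ioo)
        fun q hq => nonempty_Ioo.2 (hkm hq hu hv huv))
  by_contra! hne
  set A : Set ℝ := {p | p ∈ Icc (0 : ℝ) 1 ∧ κ (m p) < x} with hA
  have h0A : (0 : ℝ) ∈ A := ⟨⟨le_rfl, zero_le_one⟩, by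
    have := hne 0 ⟨le_rfl, zero_le_one⟩
    rw [hg0] at this ⊢
    exact lt_of_le_of_ne hx.1 this⟩
  have hbdd : BddAbove A := ⟨1, fun p hp => hp.1.2⟩
  have hs : sSup A ∈ Icc (0 : ℝ) 1 :=
    ⟨le_csSup hbdd h0A, csSup_le ⟨0, h0A⟩ fun p hp => hp.1.2⟩
  have habove : ∀ p ∈ Icc (0 : ℝ) 1, sSup A < p → x ≤ κ (m p) := fun p hp hlt => by
    by_contra! hc
    exact absurd (le_csSup hbdd (show p ∈ A from ⟨hp, hc⟩)) hlt.not_ge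
  rcases (hne _ hs).lt_or_gt with hlt | hlt
  · refine noGap _ (hgI hs) x hx hlt fun ε hε =>
      ⟨sSup A, hs, min 1 (sSup A + ε), ?_, ?_, le_rfl, ?_⟩
    · exact ⟨le_min zero_le_one (by linarith [hs.1]), min_le_left _ _⟩
    · linarith [min_le_right 1 (sSup A + ε)]
    · rcases hs.2.eq_or_lt with h1 | h1
      · rw [h1, hg1] at hlt
        exact absurd hx.2 hlt.not_ge
      · exact habove _ ⟨le_min zero_le_one (by linarith [hs.1]), min_le_left _ _⟩
          (lt_min h1 (by linarith))
  · refine noGap x hx _ (hgI hs) hlt fun ε hε => ?_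
    obtain ⟨p, hp, hpe⟩ := exists_lt_of_lt_csSup ⟨0, h0A⟩ (sub_lt_self (sSup A) hε)
    exact ⟨p, hp.1, sSup A, hs, by linarith, hp.2.le, le_rfl⟩

theorem exists_representation (h : IsQuasilinear a b κ) (hab : a < b) :
    ∃ ψ : ℝ → ℝ, ContinuousOn ψ (Icc a b) ∧ StrictMonoOn ψ (Icc a b) ∧
      ∀ μ, IsProbOn a b μ → κ μ ∈ Icc a b ∧ ψ (κ μ) = ∫ x, ψ x ∂μ := by
  have ha := isProbOn_dirac (left_mem_Icc.2 hab.le)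
  have hb := isProbOn_dirac (right_mem_Icc.2 hab.le)
  set m : ℝ → Measure ℝ := fun p => mixture p (Measure.dirac b) (Measure.dirac a) with hm
  have hmP : ∀ {p}, p ∈ Icc (0 : ℝ) 1 → IsProbOn a b (m p) := fun hp => hb.mixture hp ha
  have hκI : ∀ {μ}, IsProbOn a b μ → κ μ ∈ Icc a b := fun hμ =>
    h.mem_Icc le_rfl hab.le le_rfl hμ
  have hg : StrictMonoOn (fun p => κ (m p)) (Icc 0 1) := h.strictMonoOn hab
  choose! ψ hψI hψ using fun x (hx : x ∈ Icc a b) => h.exists_eq hab hx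
  have hψg : ∀ {p}, p ∈ Icc (0 : ℝ) 1 → ψ (κ (m p)) = p := fun hp =>
    hg.injOn (hψI _ (hκI (hmP hp))) hp (hψ _ (hκI (hmP hp)))
  have hψm : StrictMonoOn ψ (Icc a b) := fun x hx y hy hxy => by
    rw [← hg.lt_iff_lt (hψI x hx) (hψI y hy)]
    simpa only [hm, hψ x hx, hψ y hy] using hxy
  have himg : ψ '' Icc a b = Icc 0 1 :=
    (show ψ '' Icc a b ⊆ Icc 0 1 from image_subset_iff.2 fun x hx => hψI x hx).antisymm
      fun p hp => ⟨_, hκI (hmP hp), hψg hp⟩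
  have hψc : ContinuousOn ψ (Icc a b) := by
    have : OrdConnected (ψ '' Icc a b) := himg ▸ ordConnected_Icc
    rw [continuousOn_iff_continuous_domRestrict]
    exact continuous_subtype_val.comp (hψm.orderIso ψ (Icc a b)).continuous
  refine ⟨ψ, hψc, hψm, fun μ hμ => ⟨hκI hμ, ?_⟩⟩
  -- By the mixture axiom, `μ ↦ ψ (κ μ)` is affine.
  have haff : ∀ {β : ℝ} {μ ν}, β ∈ Icc (0 : ℝ) 1 → IsProbOn a b μ → IsProbOn a b ν →
      ψ (κ (mixture β μ ν)) = β * ψ (κ μ) + (1 - β) * ψ (κ ν) := by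
    intro β μ ν hβ hμ hν
    have hp := hψI _ (hκI hμ)
    have hq := hψI _ (hκI hν)
    obtain ⟨hr, he⟩ := mixture_mixture hβ hp hq hb ha
    rw [h.mixture_congr₂ hμ (hmP hp) hν (hmP hq) hβ (hψ _ (hκI hμ)).symm (hψ _ (hκI hν)).symm,
      he]
    exact hψg hr
  -- Bisecting the range of `ψ` shows that it agrees with the integral up to arbitrary precision.
  have hdev : ∀ (n : ℕ), ∀ c ∈ Icc a b, ∀ d ∈ Icc a b, c ≤ d → ∀ μ, IsProbOn c d μ →
      |ψ (κ μ) - ∫ x, ψ x ∂μ| ≤ (ψ d - ψ c) / 2 ^ n := by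
    intro n
    induction n with
    | zero =>
      intro c hc d hd hcd μ hμ
      have := hμ.1
      have hI := h.mem_Icc hc.1 hcd hd.2 hμ
      have hi : Integrable ψ μ := hμ.integrable (hψc.mono (Icc_subset_Icc hc.1 hd.2))
      have hmem : ∀ᵐ x ∂μ, x ∈ Icc c d := hμ.2
      have h1 : ψ c ≤ ∫ x, ψ x ∂μ := by
        simpa using integral_mono_ae (integrable_const (ψ c)) hi (by
          filter_upwards [hmem] with x hx
          exact hψm.monotoneOn hc ⟨hc.1.trans hx.1, hx.2.trans hd.2⟩ hx.1)
      have h2 : ∫ x, ψ x ∂μ ≤ ψ d := by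
        simpa using integral_mono_ae hi (integrable_const (ψ d)) (by
          filter_upwards [hmem] with x hx
          exact hψm.monotoneOn ⟨hc.1.trans hx.1, hx.2.trans hd.2⟩ hd hx.2)
      have hκ := hκI (hμ.mono hc.1 hd.2)
      have h3 := hψm.monotoneOn hc hκ hI.1
      have h4 := hψm.monotoneOn hκ hd hI.2
      rw [pow_zero, div_one, abs_le]
      constructor <;> linarith
    | succ n ih =>
      intro c hc d hd hcd μ hμ
      have hmid : (ψ c + ψ d) / 2 ∈ Icc (0 : ℝ) 1 := by
        have := hψI c hc
        have := hψI d hd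
        simp only [Set.mem_Icc] at *
        constructor <;> linarith
      have hψcd := hψm.monotoneOn hc hd hcd
      set e := κ (m ((ψ c + ψ d) / 2)) with he
      have heI : e ∈ Icc a b := hκI (hmP hmid)
      have hψe : ψ e = (ψ c + ψ d) / 2 := hψg hmid
      have hce : c ≤ e := (hψm.le_iff_le hc heI).1 (by linarith)
      have hed : e ≤ d := (hψm.le_iff_le heI hd).1 (by linarith)
      have e1 : (ψ e - ψ c) / 2 ^ n = (ψ d - ψ c) / 2 ^ (n + 1) := by
        rw [hψe, pow_succ]; field_simp; ring
      have e2 : (ψ d - ψ e) / 2 ^ n = (ψ d - ψ c) / 2 ^ (n + 1) := by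
        rw [hψe, pow_succ]; field_simp; ring
      have ih1 := fun μ hμ => e1 ▸ ih c hc e heI hce μ hμ
      have ih2 := fun μ hμ => e2 ▸ ih e heI d hd hed μ hμ
      rcases hμ.exists_mixture e with h' | h' | ⟨β, hβ, μ₁, μ₂, hμ₁, hμ₂, rfl⟩
      · exact ih1 μ h'
      · exact ih2 μ h'
      · have hμ₁' := hμ₁.mono hc.1 heI.2
        have hμ₂' := hμ₂.mono heI.1 hd.2
        rw [haff hβ hμ₁' hμ₂', integral_mixture hβ (hμ₁'.integrable hψc) (hμ₂'.integrable hψc)]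
        have b1 := abs_le.1 (ih1 μ₁ hμ₁)
        have b2 := abs_le.1 (ih2 μ₂ hμ₂)
        have hβ' := sub_nonneg.2 hβ.2
        rw [abs_le]
        constructor <;> nlinarith [mul_le_mul_of_nonneg_left b1.1 hβ.1,
          mul_le_mul_of_nonneg_left b1.2 hβ.1, mul_le_mul_of_nonneg_left b2.1 hβ',
          mul_le_mul_of_nonneg_left b2.2 hβ']
  have hlim : Filter.Tendsto (fun n : ℕ => (ψ b - ψ a) / 2 ^ n) Filter.atTop (nhds 0) :=
    tendsto_const_nhds.div_atTop (tendsto_pow_atTop_atTop_of_one_lt one_lt_two)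
  have := ge_of_tendsto' hlim fun n =>
    hdev n a (left_mem_Icc.2 hab.le) b (right_mem_Icc.2 hab.le) hab.le μ hμ
  exact sub_eq_zero.1 (abs_nonpos_iff.1 this)

end IsQuasilinear

/-- On increasing generators, the quasilinear mean satisfies the axioms. -/
lemma isQuasilinear_of_representation {a b : ℝ} (hab : a ≤ b) {κ : Measure ℝ → ℝ} {ψ : ℝ → ℝ}
    (hc : ContinuousOn ψ (Icc a b)) (hm : StrictMonoOn ψ (Icc a b))
    (hκ : ∀ μ, IsProbOn a b μ → κ μ ∈ Icc a b ∧ ψ (κ μ) = ∫ x, ψ x ∂μ) :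
    IsQuasilinear a b κ where
  dirac x hx := by
    obtain ⟨h1, h2⟩ := hκ _ (isProbOn_dirac hx)
    exact hm.injOn h1 hx (by simpa using h2)
  mono {μ ν} hμ hν h := by
    have := hμ.1
    have := hν.1
    rw [← hm.le_iff_le (hκ ν hν).1 (hκ μ hμ).1, (hκ ν hν).2, (hκ μ hμ).2]
    exact (integral_le_of_cdf_le hab hc hm hμ hν fun t =>
      (ENNReal.toReal_le_toReal (measure_ne_top _ _) (measure_ne_top _ _)).1 (h t)).1
  eq {μ ν} hμ hν h he := by
    have := hμ.1
    have := hν.1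
    refine (integral_le_of_cdf_le hab hc hm hμ hν fun t =>
      (ENNReal.toReal_le_toReal (measure_ne_top _ _) (measure_ne_top _ _)).1 (h t)).2 ?_
    rw [← (hκ ν hν).2, ← (hκ μ hμ).2, he]
  mixture_congr {μ ν ρ} hμ hν hρ β hβ he := by
    have h1 := hκ _ (hμ.mixture hβ hρ)
    have h2 := hκ _ (hν.mixture hβ hρ)
    refine hm.injOn h1.1 h2.1 ?_
    rw [h1.2, h2.2, integral_mixture hβ (hμ.integrable hc) (hρ.integrable hc),
      integral_mixture hβ (hν.integrable hc) (hρ.integrable hc), ← (hκ μ hμ).2,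
      ← (hκ ν hν).2, he]

/-- **Quasilinear mean representation theorem (Kolmogorov–Nagumo–de Finetti /
Hardy–Littlewood–Pólya Thm 215).**  A real functional `κ` on the Borel
probability measures supported on a compact interval `[a,b]` satisfies
(1) consistency with certainty `κ (δ_x) = x`,
(2) monotonicity with respect to pointwise ordering of CDFs (with equality of
the means iff the measures coincide), and
(3) quasilinearity under mixtures,
if and only if there is a continuous strictly monotone `ψ` on `[a,b]` such
that `κ μ` is the quasilinear mean `ψ⁻¹ (∫ ψ dμ)`, i.e. `κ μ ∈ [a,b]` and
`ψ (κ μ) = ∫ ψ dμ` for every such measure `μ`. -/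
theorem quasilinear_mean_representation
    (a b : ℝ) (hab : a ≤ b) (κ : Measure ℝ → ℝ) :
    ((∀ x ∈ Set.Icc a b, κ (Measure.dirac x) = x) ∧
     (∀ μ ν : Measure ℝ, IsProbabilityMeasure μ → IsProbabilityMeasure ν →
        μ (Set.Icc a b)ᶜ = 0 → ν (Set.Icc a b)ᶜ = 0 →
        (∀ t : ℝ, μ (Set.Iic t) ≤ ν (Set.Iic t)) →
        κ ν ≤ κ μ ∧ (κ ν = κ μ ↔ μ = ν)) ∧
     (∀ μ ν lam : Measure ℝ, IsProbabilityMeasure μ → IsProbabilityMeasure ν →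
        IsProbabilityMeasure lam →
        μ (Set.Icc a b)ᶜ = 0 → ν (Set.Icc a b)ᶜ = 0 → lam (Set.Icc a b)ᶜ = 0 →
        ∀ β : NNReal, β ≤ 1 → κ μ = κ ν →
        κ (β • μ + (1 - β) • lam) = κ (β • ν + (1 - β) • lam)))
    ↔
    (∃ ψ : ℝ → ℝ, ContinuousOn ψ (Set.Icc a b) ∧
      (StrictMonoOn ψ (Set.Icc a b) ∨ StrictAntiOn ψ (Set.Icc a b)) ∧
      ∀ μ : Measure ℝ, IsProbabilityMeasure μ → μ (Set.Icc a b)ᶜ = 0 →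
        κ μ ∈ Set.Icc a b ∧ ψ (κ μ) = ∫ x, ψ x ∂μ) := by
  have hmix : ∀ (β : NNReal) (μ ν : Measure ℝ), mixture β μ ν = β • μ + (1 - β) • ν := by
    intro β μ ν
    rw [mixture, Real.toNNReal_coe, ← NNReal.coe_one, ← NNReal.sub_def]
  have hreal : ∀ {μ ν : Measure ℝ}, IsProbOn a b μ → IsProbOn a b ν →
      ((∀ t, μ.real (Iic t) ≤ ν.real (Iic t)) ↔ ∀ t, μ (Iic t) ≤ ν (Iic t)) := by
    intro μ ν hμ hν
    have := hμ.1
    have := hν.1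
    exact forall_congr' fun t =>
      ENNReal.toReal_le_toReal (measure_ne_top _ _) (measure_ne_top _ _)
  have hiff : ((∀ x ∈ Set.Icc a b, κ (Measure.dirac x) = x) ∧
     (∀ μ ν : Measure ℝ, IsProbabilityMeasure μ → IsProbabilityMeasure ν →
        μ (Set.Icc a b)ᶜ = 0 → ν (Set.Icc a b)ᶜ = 0 →
        (∀ t : ℝ, μ (Set.Iic t) ≤ ν (Set.Iic t)) →
        κ ν ≤ κ μ ∧ (κ ν = κ μ ↔ μ = ν)) ∧
     (∀ μ ν lam : Measure ℝ, IsProbabilityMeasure μ → IsProbabilityMeasure ν →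
        IsProbabilityMeasure lam →
        μ (Set.Icc a b)ᶜ = 0 → ν (Set.Icc a b)ᶜ = 0 → lam (Set.Icc a b)ᶜ = 0 →
        ∀ β : NNReal, β ≤ 1 → κ μ = κ ν →
        κ (β • μ + (1 - β) • lam) = κ (β • ν + (1 - β) • lam))) ↔ IsQuasilinear a b κ := by
    constructor
    · rintro ⟨h1, h2, h3⟩
      refine ⟨h1, fun hμ hν h => (h2 _ _ hμ.1 hν.1 hμ.2 hν.2 ((hreal hμ hν).1 h)).1,
        fun hμ hν h => (h2 _ _ hμ.1 hν.1 hμ.2 hν.2 ((hreal hμ hν).1 h)).2.1,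
        fun {μ ν ρ} hμ hν hρ β hβ he => ?_⟩
      lift β to NNReal using hβ.1
      rw [hmix, hmix]
      exact h3 _ _ _ hμ.1 hν.1 hρ.1 hμ.2 hν.2 hρ.2 β hβ.2 he
    · intro h
      refine ⟨h.dirac, fun μ ν hμ hν hμ' hν' hd => ?_,
        fun μ ν lam hμ hν hl hμ' hν' hl' β hβ he => ?_⟩
      · have hd' := (hreal ⟨hμ, hμ'⟩ ⟨hν, hν'⟩).2 hd
        exact ⟨h.mono ⟨hμ, hμ'⟩ ⟨hν, hν'⟩ hd', h.eq ⟨hμ, hμ'⟩ ⟨hν, hν'⟩ hd', fun e => by rw [e]⟩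
      · rw [← hmix, ← hmix]
        exact h.mixture_congr ⟨hμ, hμ'⟩ ⟨hν, hν'⟩ ⟨hl, hl'⟩ ⟨β.2, hβ⟩ he
  rw [hiff]
  constructor
  · intro h
    rcases hab.eq_or_lt with rfl | hlt
    · refine ⟨id, continuousOn_id, .inl (strictMono_id.strictMonoOn _), fun μ hμ hμ' => ?_⟩
      have hκ := h.mem_Icc le_rfl le_rfl le_rfl ⟨hμ, hμ'⟩
      have hae : id =ᵐ[μ] fun _ => a := by
        filter_upwards [show ∀ᵐ x ∂μ, x ∈ Icc a a from hμ'] with x hx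
        simpa using hx
      refine ⟨hκ, ?_⟩
      rw [integral_congr_ae hae]
      simpa using hκ
    · obtain ⟨ψ, hc, hm, hκ⟩ := h.exists_representation hlt
      exact ⟨ψ, hc, .inl hm, fun μ hμ hμ' => hκ μ ⟨hμ, hμ'⟩⟩
  · rintro ⟨ψ, hc, hm | hm, hκ⟩
    · exact isQuasilinear_of_representation hab hc hm fun μ hμ => hκ μ hμ.1 hμ.2
    · refine isQuasilinear_of_representation hab hc.neg hm.neg fun μ hμ => ?_
      obtain ⟨h1, h2⟩ := hκ μ hμ.1 hμ.2
      refine ⟨h1, ?_⟩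
      simp only [Pi.neg_apply, integral_neg, h2]
end
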